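/- (Claim 3 in the proof of the main theorem.) Assume condition (*) holds for every n ∈ ℕ. Let n ∈ ℕ and let s, u ∈ {0,1,2}^{k_n−1} be such that J_s and J_u are associated intervals with J_u covering the family 𝒢^0_s. Then for any gaps G ∈ 𝒢^0_s and H ∈ 𝒢^1_u we have G ∩ H = ∅; moreover, for any D ∈ 𝒢^1_s and F ∈ 𝒢^0_u we have D ∩ H = ∅, G ∩ F = ∅ and D ∩ F = ∅. -/

import Mathlib

open Pointwise MeasureTheory

namespace CCS

/-- `dSeq a n` is the common length `d_n = ∏_{i=1}^n (1 - a_i)/2` of the intervals of the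
`n`-th step of the construction of the central Cantor set `C(a)` (`d_0 = 1`).
The sequence `a` is indexed from `1`; the value `a 0` is irrelevant. -/
noncomputable def dSeq (a : ℕ → ℝ) (n : ℕ) : ℝ :=
  ∏ i ∈ Finset.Icc 1 n, ((1 - a i) / 2)

/-- Left endpoint of the interval `I_t`, `t ∈ {0,1}^n` (coded as a list, the paper's
`t_j` being `t.getD (j-1) 0`): `l(I_t) = ∑_{j=1}^n t_j (d_{j-1} - d_j)`. -/
noncomputable def Il (a : ℕ → ℝ) (t : List ℕ) : ℝ :=
  ∑ j ∈ Finset.range t.length, (t.getD j 0 : ℝ) * (dSeq a j - dSeq a (j + 1))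

/-- The `n`-th step `C_n(a)` of the construction of the central Cantor set:
the union of the intervals `I_t = [l(I_t), l(I_t) + d_n]` over `t ∈ {0,1}^n`. -/
noncomputable def cantorStep (a : ℕ → ℝ) (n : ℕ) : Set ℝ :=
  ⋃ t ∈ {t : List ℕ | t.length = n ∧ ∀ j ∈ t, j ≤ 1},
    Set.Icc (Il a t) (Il a t + dSeq a n)

/-- The central Cantor set `C(a) = ⋂ₙ C_n(a)`. -/
noncomputable def cantorSet (a : ℕ → ℝ) : Set ℝ := ⋂ n, cantorStep a n

/-- Left endpoint of the interval `J_s = I_t - I_p`, for `s ∈ {0,1,2}^n`: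
`l(J_s) = -1 + ∑_{j=1}^n s_j (d_{j-1} - d_j)`. -/
noncomputable def Jl (a : ℕ → ℝ) (s : List ℕ) : ℝ :=
  -1 + ∑ j ∈ Finset.range s.length, (s.getD j 0 : ℝ) * (dSeq a j - dSeq a (j + 1))

/-- Right endpoint of `J_s`: `r(J_s) = l(J_s) + 2 d_n`. -/
noncomputable def Jr (a : ℕ → ℝ) (s : List ℕ) : ℝ :=
  Jl a s + 2 * dSeq a s.length

/-- The interval `J_s`. -/
noncomputable def Jset (a : ℕ → ℝ) (s : List ℕ) : Set ℝ := Set.Icc (Jl a s) (Jr a s)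

/-- Left endpoint of the gap `G^i_s` (`i = 0`: left gap, `i = 1`: right gap) of `J_s`. -/
noncomputable def Gl (a : ℕ → ℝ) (i : ℕ) (s : List ℕ) : ℝ :=
  Jl a s + (i : ℝ) * (dSeq a s.length - dSeq a (s.length + 1)) + 2 * dSeq a (s.length + 1)

/-- Right endpoint of the gap `G^i_s`. -/
noncomputable def Gr (a : ℕ → ℝ) (i : ℕ) (s : List ℕ) : ℝ :=
  Jl a s + ((i : ℝ) + 1) * (dSeq a s.length - dSeq a (s.length + 1))

/-- The gap `G^i_s ⊆ J_s`, an open interval. -/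
noncomputable def Gset (a : ℕ → ℝ) (i : ℕ) (s : List ℕ) : Set ℝ :=
  Set.Ioo (Gl a i s) (Gr a i s)

/-- `N(0,s) = max {j : s_j > 0}`, `N(1,s) = max {j : s_j < 2}` (1-based, `max ∅ = 0`). -/
noncomputable def Nidx (i : ℕ) (s : List ℕ) : ℕ :=
  sSup {j | 1 ≤ j ∧ j ≤ s.length ∧
    (if i = 0 then 0 < s.getD (j - 1) 0 else s.getD (j - 1) 0 < 2)}

/-- The family `𝒢^{i0}_{s0}(n)` of (indices of) gaps of rank `n`, for
`s0 ∈ {0,1,2}^{k_m - 1}`; a gap `G^i_s` is coded by the pair `(i, s)`.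
`𝒢^{i0}_{s0}(m) = {G^{i0}_{s0}}` and for `n > m`,
`𝒢^{i0}_{s0}(n)` consists of the gap `Ḡ^{i0}_{s0}(n)` together with the gaps
`Ḡ^1_{t^j}(n)`, `Ḡ^0_{t^(j+1)}(n)` for all `G^j_t ∈ 𝒢^{i0}_{s0}(l)`, `m ≤ l < n`. -/
def gapFamily (k : ℕ → ℕ) (i0 : ℕ) (s0 : List ℕ) (m : ℕ) (n : ℕ) : Set (ℕ × List ℕ) :=
  if n ≤ m then {(i0, s0)}
  else
    {(i0, s0 ++ List.replicate (k n - k m) (2 * i0))} ∪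
      ⋃ (l : ℕ) (_ : m ≤ l) (hl : l < n),
        ⋃ p ∈ gapFamily k i0 s0 m l,
          ({(1, p.2 ++ p.1 :: List.replicate (k n - k l - 1) 2),
            (0, p.2 ++ (p.1 + 1) :: List.replicate (k n - k l - 1) 0)} : Set (ℕ × List ℕ))
termination_by n
decreasing_by exact hl

/-- The family `𝒢^{i0}_{s0} = ⋃_{n ≥ m} 𝒢^{i0}_{s0}(n)`. -/
def gapFamilyAll (k : ℕ → ℕ) (i0 : ℕ) (s0 : List ℕ) (m : ℕ) : Set (ℕ × List ℕ) :=
  ⋃ (n : ℕ) (_ : m ≤ n), gapFamily k i0 s0 m n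

/-- The family `𝒢_t := 𝒢^0_{t ++ 0^{(k_m - |t| - 1)}} ∪ 𝒢^1_{t ++ 2^{(k_m - |t| - 1)}}`
for `t ∈ {0,1,2}^k` with `k_{m-1} ≤ k < k_m`. -/
def gapFamilyT (k : ℕ → ℕ) (m : ℕ) (t : List ℕ) : Set (ℕ × List ℕ) :=
  gapFamilyAll k 0 (t ++ List.replicate (k m - t.length - 1) 0) m ∪
    gapFamilyAll k 1 (t ++ List.replicate (k m - t.length - 1) 2) m

/-- The union `⋃ 𝒢` of a family of (indices of) gaps, as a subset of `ℝ`. -/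
noncomputable def gapUnion (a : ℕ → ℝ) (G : Set (ℕ × List ℕ)) : Set ℝ :=
  ⋃ p ∈ G, Gset a p.1 p.2

/-- `padSeq k c s m n` is the index of the gap `G^i(s,n)` (for `c = 2i`):
`s ++ c^{(k_m - |s| - 1)} ++ 1 ++ c^{(k_{m+1} - k_m - 1)} ++ 1 ++ ⋯ ++ 1 ++ c^{(k_n - k_{n-1} - 1)}`. -/
def padSeq (k : ℕ → ℕ) (c : ℕ) (s : List ℕ) (m : ℕ) : ℕ → List ℕ
  | 0 => s ++ List.replicate (k m - s.length - 1) c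
  | n + 1 =>
    if n + 1 ≤ m then s ++ List.replicate (k m - s.length - 1) c
    else padSeq k c s m n ++ 1 :: List.replicate (k (n + 1) - k n - 1) c

/-- `δ_n := min {3d_i - d_{i-1} : k_{n-1} + 1 ≤ i ≤ k_n - 1}` (as an element of `EReal`,
so that `min ∅ = ⊤ = ∞`). -/
noncomputable def deltaMin (a : ℕ → ℝ) (k : ℕ → ℕ) (n : ℕ) : EReal :=
  sInf ((fun i => ((3 * dSeq a i - dSeq a (i - 1) : ℝ) : EReal)) ''
    (Set.Icc (k (n - 1) + 1) (k n - 1)))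

/-- `Δ_n := max {3d_i - d_{i-1} : k_{n-1} + 1 ≤ i ≤ k_n - 1}` (`max ∅ = ⊥ = -∞`). -/
noncomputable def deltaMax (a : ℕ → ℝ) (k : ℕ → ℕ) (n : ℕ) : EReal :=
  sSup ((fun i => ((3 * dSeq a i - dSeq a (i - 1) : ℝ) : EReal)) ''
    (Set.Icc (k (n - 1) + 1) (k n - 1)))

/-- `m_n := min { δ_n - (d_{k_n - 1} - d_{k_n}), 4 d_{k_n} - Δ_n }`. -/
noncomputable def mSeq (a : ℕ → ℝ) (k : ℕ → ℕ) (n : ℕ) : EReal :=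
  min (deltaMin a k n - ((dSeq a (k n - 1) - dSeq a (k n) : ℝ) : EReal))
    (((4 * dSeq a (k n) : ℝ) : EReal) - deltaMax a k n)

/-- `∑_{i=n+1}^∞ (d_{k_i - 1} - d_{k_i})`. -/
noncomputable def tailSum (a : ℕ → ℝ) (k : ℕ → ℕ) (n : ℕ) : ℝ :=
  ∑' i : ℕ, (dSeq a (k (n + 1 + i) - 1) - dSeq a (k (n + 1 + i)))

/-- Condition `(*)`: `m_n ≥ 2 ∑_{i=n+1}^∞ (d_{k_i - 1} - d_{k_i})` for every `n ∈ ℕ`. -/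
def condStar (a : ℕ → ℝ) (k : ℕ → ℕ) : Prop :=
  ∀ n : ℕ, 1 ≤ n → ((2 * tailSum a k n : ℝ) : EReal) ≤ mSeq a k n

/-- `(k_n)_{n ≥ 1}` is the increasing enumeration of all indices greater than `k 0 = k₀`
at which `a` exceeds `1/3`. -/
def IsGapEnum (a : ℕ → ℝ) (k : ℕ → ℕ) : Prop :=
  StrictMono k ∧ (∀ n, 1 ≤ n → k 0 < k n ∧ 1 / 3 < a (k n)) ∧
    (∀ j, k 0 < j → 1 / 3 < a j → ∃ n, 1 ≤ n ∧ k n = j)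

/-- `G` is a gap of `E`: a bounded connected component of `ℝ ∖ E`. -/
def IsGapOf (E G : Set ℝ) : Prop :=
  (∃ x ∉ E, G = connectedComponentIn Eᶜ x) ∧ Bornology.IsBounded G

/-- `C` is a proper (nontrivial) connected component of `E`. -/
def IsProperComponentOf (E C : Set ℝ) : Prop :=
  (∃ x ∈ E, C = connectedComponentIn E x) ∧ C.Nontrivial

/-- `E` is a Cantorval: a perfect set with infinitely many gaps such that both endpoints
of every gap are accumulated both by gaps and by proper components of `E`. -/
def IsCantorval (E : Set ℝ) : Prop :=
  Perfect E ∧ {G : Set ℝ | IsGapOf E G}.Infinite ∧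
    ∀ G, IsGapOf E G → ∀ p, p = sInf G ∨ p = sSup G →
      (∀ ε > 0, ∃ G', IsGapOf E G' ∧ G' ≠ G ∧ G' ⊆ Set.Ioo (p - ε) (p + ε)) ∧
      (∀ ε > 0, ∃ C, IsProperComponentOf E C ∧ C ⊆ Set.Ioo (p - ε) (p + ε))

/-- `J_s` and `J_u` (of length `k_m - 1`) are associated:
`N := N(0,s) = N(1,u) ∈ {k_{m-1}+1, …, k_m - 1}`, `s|(N-1) = u|(N-1)`, `u_N = s_N - 1`.
Then `J_u` is the interval covering `𝒢^0_s` and `J_s` is the interval covering `𝒢^1_u`. -/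
def Associated (k : ℕ → ℕ) (m : ℕ) (s u : List ℕ) : Prop :=
  s.length = k m - 1 ∧ u.length = k m - 1 ∧
    Nidx 0 s = Nidx 1 u ∧
    k (m - 1) + 1 ≤ Nidx 0 s ∧ Nidx 0 s ≤ k m - 1 ∧
    s.take (Nidx 0 s - 1) = u.take (Nidx 0 s - 1) ∧
    u.getD (Nidx 0 s - 1) 0 = s.getD (Nidx 0 s - 1) 0 - 1

/-- `G^i_g ⊂_* J_v`: the gap `G^i_g` is covered by the interval `J_v`, i.e. `G^i_g`
belongs to a family `𝒢^0_w` (resp. `𝒢^1_w`) such that `J_v` is the interval covering it. -/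
def CoversGap (k : ℕ → ℕ) (i : ℕ) (g : List ℕ) (v : List ℕ) : Prop :=
  ∃ m w, 1 ≤ m ∧
    ((Associated k m w v ∧ (i, g) ∈ gapFamilyAll k 0 w m) ∨
      (Associated k m v w ∧ (i, g) ∈ gapFamilyAll k 1 w m))

/-- The achievement set `E(x) = {∑_{j ∈ A} x_j : A ⊆ ℕ}` of a series (indexed from `1`). -/
def achievementSet (x : ℕ → ℝ) : Set ℝ :=
  {y | ∃ A : Set ℕ, A ⊆ {n | 1 ≤ n} ∧ HasSum (A.indicator x) y}

theorem dSeq_succ (a : ℕ → ℝ) (n : ℕ) : dSeq a (n + 1) = dSeq a n * ((1 - a (n + 1)) / 2) := by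
  unfold dSeq
  rw [Finset.prod_Icc_succ_top (by omega)]

theorem dSeq_pos {a : ℕ → ℝ} (ha : ∀ n, 1 ≤ n → 0 < a n ∧ a n < 1) (n : ℕ) : 0 < dSeq a n := by
  unfold dSeq
  apply Finset.prod_pos
  intro i hi
  have := ha i (Finset.mem_Icc.1 hi).1
  linarith [this.2]

theorem dSeq_anti {a : ℕ → ℝ} (ha : ∀ n, 1 ≤ n → 0 < a n ∧ a n < 1) : Antitone (dSeq a) := by
  apply antitone_nat_of_succ_le
  intro n
  rw [dSeq_succ]
  have := ha (n + 1) (by omega)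
  have h := dSeq_pos ha n
  nlinarith [this.1]

theorem dSeq_gap {a : ℕ → ℝ} (ha : ∀ n, 1 ≤ n → 0 < a n ∧ a n < 1) (n : ℕ)
    (h : 1 / 3 < a (n + 1)) : 3 * dSeq a (n + 1) ≤ dSeq a n := by
  rw [dSeq_succ]
  have h := dSeq_pos ha n
  nlinarith

theorem Jl_snoc (a : ℕ → ℝ) (s : List ℕ) (c : ℕ) :
    Jl a (s ++ [c]) = Jl a s + c * (dSeq a s.length - dSeq a (s.length + 1)) := by
  unfold Jl
  rw [List.length_append, List.length_singleton, Finset.sum_range_succ, add_assoc]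
  congr 2
  · apply Finset.sum_congr rfl
    intro j hj
    rw [List.getD_append _ _ _ _ (Finset.mem_range.1 hj)]
  · rw [List.getD_append_right _ _ _ _ le_rfl]
    simp

theorem Jl_replicate (a : ℕ → ℝ) (s : List ℕ) (r c : ℕ) :
    Jl a (s ++ List.replicate r c) = Jl a s + c * (dSeq a s.length - dSeq a (s.length + r)) := by
  induction r with
  | zero => simp
  | succ r ih =>
    rw [List.replicate_succ', ← List.append_assoc, Jl_snoc, ih, List.length_append,
      List.length_replicate, ← add_assoc]
    ring

theorem G_left (a : ℕ → ℝ) (s : List ℕ) (r m : ℕ) (hm : s.length + r = m) :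
    Gl a 0 (s ++ List.replicate r 0) = Jl a s + 2 * dSeq a (m + 1) ∧
    Gr a 0 (s ++ List.replicate r 0) = Jl a s + (dSeq a m - dSeq a (m + 1)) := by
  unfold Gl Gr
  rw [Jl_replicate, List.length_append, List.length_replicate, hm]
  constructor <;> push_cast <;> ring

theorem G_right (a : ℕ → ℝ) (s : List ℕ) (r m : ℕ) (hm : s.length + r = m) :
    Gl a 1 (s ++ List.replicate r 2) = Jr a s - (dSeq a m - dSeq a (m + 1)) ∧
    Gr a 1 (s ++ List.replicate r 2) = Jr a s - 2 * dSeq a (m + 1) := by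
  unfold Gl Gr Jr
  rw [Jl_replicate, List.length_append, List.length_replicate, hm]
  constructor <;> push_cast <;> ring

theorem Jr_snoc (a : ℕ → ℝ) (s : List ℕ) (c : ℕ) : Jr a (s ++ [c]) = Gl a c s := by
  unfold Jr Gl
  rw [Jl_snoc, List.length_append, List.length_singleton]

theorem Jl_snoc_succ (a : ℕ → ℝ) (s : List ℕ) (c : ℕ) : Jl a (s ++ [c + 1]) = Gr a c s := by
  unfold Gr
  rw [Jl_snoc]
  push_cast
  ring

/-- both endpoints of the gap lie within `S` of `[lo, hi]` -/
def Near (a : ℕ → ℝ) (lo hi S : ℝ) (p : ℕ × List ℕ) : Prop :=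
  (lo - S ≤ Gl a p.1 p.2 ∧ Gl a p.1 p.2 ≤ hi + S) ∧
    (lo - S ≤ Gr a p.1 p.2 ∧ Gr a p.1 p.2 ≤ hi + S)

theorem near_step {a : ℕ → ℝ} {lo hi S S' D : ℝ} {p q : ℕ × List ℕ} (hp : Near a lo hi S p)
    (hS : S + D ≤ S')
    (h : (Gl a p.1 p.2 - D ≤ Gl a q.1 q.2 ∧ Gl a q.1 q.2 ≤ Gl a p.1 p.2 ∧
          Gl a p.1 p.2 - D ≤ Gr a q.1 q.2 ∧ Gr a q.1 q.2 ≤ Gl a p.1 p.2) ∨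
         (Gr a p.1 p.2 + D ≥ Gl a q.1 q.2 ∧ Gl a q.1 q.2 ≥ Gr a p.1 p.2 ∧
          Gr a p.1 p.2 + D ≥ Gr a q.1 q.2 ∧ Gr a q.1 q.2 ≥ Gr a p.1 p.2)) :
    Near a lo hi S' q := by
  obtain ⟨⟨h1, h2⟩, h3, h4⟩ := hp
  rcases h with ⟨a1, a2, a3, a4⟩ | ⟨a1, a2, a3, a4⟩ <;>
    refine ⟨⟨?_, ?_⟩, ?_, ?_⟩ <;> linarith

/-- Finite partial sums. -/
noncomputable def partS (a : ℕ → ℝ) (k : ℕ → ℕ) (n l : ℕ) : ℝ :=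
  ∑ i ∈ Finset.range (l - n), (dSeq a (k (n + 1 + i) - 1) - dSeq a (k (n + 1 + i)))

theorem D_nonneg {a : ℕ → ℝ} (ha : ∀ n, 1 ≤ n → 0 < a n ∧ a n < 1) (j : ℕ) :
    0 ≤ dSeq a (j - 1) - dSeq a j := by
  linarith [dSeq_anti ha (Nat.sub_le j 1)]

theorem partS_step {a : ℕ → ℝ} {k : ℕ → ℕ} (ha : ∀ n, 1 ≤ n → 0 < a n ∧ a n < 1) {n l m : ℕ}
    (hl : n ≤ l) (hm : l < m) :
    partS a k n l + (dSeq a (k m - 1) - dSeq a (k m)) ≤ partS a k n m := by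
  obtain ⟨r, rfl⟩ : ∃ r, m = n + 1 + r := ⟨m - (n + 1), by omega⟩
  unfold partS
  rw [show n + 1 + r - n = r + 1 by omega, Finset.sum_range_succ]
  refine add_le_add ?_ le_rfl
  apply Finset.sum_le_sum_of_subset_of_nonneg
  · intro x; simp only [Finset.mem_range]; omega
  · intros; exact D_nonneg ha _

theorem summable_D {a : ℕ → ℝ} {k : ℕ → ℕ} (ha : ∀ n, 1 ≤ n → 0 < a n ∧ a n < 1)
    (hk : StrictMono k) (n : ℕ) :
    Summable fun i : ℕ => dSeq a (k (n + 1 + i) - 1) - dSeq a (k (n + 1 + i)) := by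
  have key : ∀ M, ∑ i ∈ Finset.range M, (dSeq a (k (n + 1 + i) - 1) - dSeq a (k (n + 1 + i)))
      ≤ dSeq a 0 - dSeq a (k (n + M)) := by
    intro M
    induction M with
    | zero => simpa using dSeq_anti ha (Nat.zero_le _)
    | succ M ih =>
      rw [Finset.sum_range_succ]
      have h1 : k (n + M) < k (n + 1 + M) := hk (by omega)
      have h2 := dSeq_anti ha (show k (n + M) ≤ k (n + 1 + M) - 1 by omega)
      rw [show n + (M + 1) = n + 1 + M by omega]
      linarith
  refine summable_of_sum_range_le (c := dSeq a 0) (fun i => D_nonneg ha _) fun M => ?_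
  linarith [key M, dSeq_pos ha (k (n + M))]

theorem partS_le {a : ℕ → ℝ} {k : ℕ → ℕ} (ha : ∀ n, 1 ≤ n → 0 < a n ∧ a n < 1)
    (hk : StrictMono k) (n l : ℕ) : partS a k n l ≤ tailSum a k n :=
  (summable_D ha hk n).sum_le_tsum _ fun i _ => D_nonneg ha _

theorem family_bound {a : ℕ → ℝ} {k : ℕ → ℕ} (ha : ∀ n, 1 ≤ n → 0 < a n ∧ a n < 1)
    (hk : IsGapEnum a k) {n : ℕ} (hn : 1 ≤ n) (i0 : ℕ) (s0 : List ℕ)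
    (hs : s0.length = k n - 1) (e : ℝ) (he : (i0 = 0 ∧ e = Jl a s0) ∨ (i0 = 1 ∧ e = Jr a s0))
    (l : ℕ) : n ≤ l → ∀ p ∈ gapFamily k i0 s0 n l, p.2.length = k l - 1 ∧
      (Near a e e (partS a k n l) p ∨
        (Near a (Gl a i0 s0) (Gr a i0 s0) (partS a k n l) p)) := by
  induction l using Nat.strong_induction_on with
  | _ l ih =>
  intro hl p hp
  have hkm := hk.1
  have hkn : k 0 < k n := hkm (by omega)
  have gap : ∀ j, 1 ≤ j → 3 * dSeq a (k j) ≤ dSeq a (k j - 1) := by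
    intro j hj
    obtain ⟨h1, h2⟩ := hk.2.1 j hj
    have := dSeq_gap ha (k j - 1)
    rw [show k j - 1 + 1 = k j by omega] at this
    exact this h2
  rw [gapFamily] at hp
  split_ifs at hp with h
  · obtain rfl : l = n := by omega
    obtain rfl : p = (i0, s0) := hp
    refine ⟨hs, Or.inr ?_⟩
    have g := gap l hn
    have : Gl a i0 s0 ≤ Gr a i0 s0 := by
      unfold Gl Gr
      rw [hs, show k l - 1 + 1 = k l by omega]
      linarith
    have h0 : partS a k l l = 0 := by simp [partS]
    unfold Near
    rw [h0]
    simp [this]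
  · have hnl : k n < k l := hkm (by omega)
    have g := gap l (by omega)
    have dp := dSeq_pos ha (k l)
    have hl1 : k l - 1 + 1 = k l := by omega
    rcases hp with hp | hp
    · obtain rfl : p = _ := hp
      refine ⟨by simp [hs]; omega, Or.inl ?_⟩
      have st := partS_step (k := k) ha (le_refl n) (show n < l by omega)
      have h0 : partS a k n n = 0 := by simp [partS]
      unfold Near
      rcases he with ⟨rfl, rfl⟩ | ⟨rfl, rfl⟩
      · obtain ⟨q1, q2⟩ := G_left a s0 (k l - k n) (k l - 1) (by omega)
        simp only [mul_zero]
        rw [q1, q2, hl1]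
        refine ⟨⟨?_, ?_⟩, ?_, ?_⟩ <;> linarith
      · obtain ⟨q1, q2⟩ := G_right a s0 (k l - k n) (k l - 1) (by omega)
        simp only [mul_one]
        rw [q1, q2, hl1]
        refine ⟨⟨?_, ?_⟩, ?_, ?_⟩ <;> linarith
    · simp only [Set.mem_iUnion] at hp
      obtain ⟨l', h1, h2, q, hq, hp⟩ := hp
      obtain ⟨ql, qn⟩ := ih l' h2 h1 q hq
      have hll : k l' < k l := hkm h2
      have hnl' : k n ≤ k l' := hkm.monotone h1
      have st := partS_step (k := k) ha h1 h2
      have key : p.2.length = k l - 1 ∧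
         ((Gl a q.1 q.2 - (dSeq a (k l - 1) - dSeq a (k l)) ≤ Gl a p.1 p.2 ∧
            Gl a p.1 p.2 ≤ Gl a q.1 q.2 ∧
            Gl a q.1 q.2 - (dSeq a (k l - 1) - dSeq a (k l)) ≤ Gr a p.1 p.2 ∧
            Gr a p.1 p.2 ≤ Gl a q.1 q.2) ∨
         (Gr a q.1 q.2 + (dSeq a (k l - 1) - dSeq a (k l)) ≥ Gl a p.1 p.2 ∧
            Gl a p.1 p.2 ≥ Gr a q.1 q.2 ∧
            Gr a q.1 q.2 + (dSeq a (k l - 1) - dSeq a (k l)) ≥ Gr a p.1 p.2 ∧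
            Gr a p.1 p.2 ≥ Gr a q.1 q.2)) := by
        rcases hp with hp | hp
        · obtain rfl : p = _ := hp
          refine ⟨by simp [ql]; omega, Or.inl ?_⟩
          obtain ⟨q1, q2⟩ := G_right a (q.2 ++ [q.1]) (k l - k l' - 1) (k l - 1)
            (by simp [ql]; omega)
          rw [List.append_assoc, List.singleton_append, Jr_snoc, hl1] at q1 q2
          simp only
          rw [q1, q2]
          refine ⟨?_, ?_, ?_, ?_⟩ <;> linarith
        · obtain rfl : p = _ := hp
          refine ⟨by simp [ql]; omega, Or.inr ?_⟩
          obtain ⟨q1, q2⟩ := G_left a (q.2 ++ [q.1 + 1]) (k l - k l' - 1) (k l - 1)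
            (by simp [ql]; omega)
          rw [List.append_assoc, List.singleton_append, Jl_snoc_succ, hl1] at q1 q2
          simp only
          rw [q1, q2]
          refine ⟨?_, ?_, ?_, ?_⟩ <;> linarith
      exact ⟨key.1, qn.imp (fun h => near_step h st key.2) (fun h => near_step h st key.2)⟩

theorem familyAll_bound {a : ℕ → ℝ} {k : ℕ → ℕ} (ha : ∀ n, 1 ≤ n → 0 < a n ∧ a n < 1)
    (hk : IsGapEnum a k) {n : ℕ} (hn : 1 ≤ n) (i0 : ℕ) (s0 : List ℕ)
    (hs : s0.length = k n - 1) (e : ℝ) (he : (i0 = 0 ∧ e = Jl a s0) ∨ (i0 = 1 ∧ e = Jr a s0))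
    (p : ℕ × List ℕ) (hp : p ∈ gapFamilyAll k i0 s0 n) :
      (e - tailSum a k n ≤ Gl a p.1 p.2 ∧ Gr a p.1 p.2 ≤ e + tailSum a k n) ∨
      (Gl a i0 s0 - tailSum a k n ≤ Gl a p.1 p.2 ∧
        Gr a p.1 p.2 ≤ Gr a i0 s0 + tailSum a k n) := by
  simp only [gapFamilyAll, Set.mem_iUnion] at hp
  obtain ⟨l, hl, hp⟩ := hp
  have h1 := partS_le ha hk.1 n l
  rcases (family_bound ha hk hn i0 s0 hs e he l hl p hp).2 with h | h
  · left; obtain ⟨⟨_, _⟩, _, _⟩ := h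
    constructor <;> linarith
  · right; obtain ⟨⟨_, _⟩, _, _⟩ := h
    constructor <;> linarith

theorem Nidx_spec (i : ℕ) (s : List ℕ) (h : 1 ≤ Nidx i s) :
    (Nidx i s ≤ s.length ∧
      (if i = 0 then 0 < s.getD (Nidx i s - 1) 0 else s.getD (Nidx i s - 1) 0 < 2)) ∧
    ∀ j, Nidx i s < j → j ≤ s.length →
      ¬ (if i = 0 then 0 < s.getD (j - 1) 0 else s.getD (j - 1) 0 < 2) := by
  set A : Set ℕ := {j | 1 ≤ j ∧ j ≤ s.length ∧
    (if i = 0 then 0 < s.getD (j - 1) 0 else s.getD (j - 1) 0 < 2)} with hA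
  have hN : Nidx i s = sSup A := rfl
  have bdd : BddAbove A := ⟨s.length, fun j hj => hj.2.1⟩
  have ne : A.Nonempty := by
    by_contra hne
    rw [Set.not_nonempty_iff_eq_empty] at hne
    rw [hN, hne] at h
    simp at h
  have hm := Nat.sSup_mem ne bdd
  rw [← hN] at hm
  refine ⟨hm.2, fun j hj hjl hc => ?_⟩
  have : j ≤ sSup A := le_csSup bdd ⟨by omega, hjl, hc⟩
  omega

theorem split_at (s : List ℕ) (N c : ℕ) (h1 : 1 ≤ N) (hN : N ≤ s.length)
    (hc : ∀ j, N < j → j ≤ s.length → s.getD (j - 1) 0 = c) :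
    s = (s.take (N - 1) ++ [s.getD (N - 1) 0]) ++ List.replicate (s.length - N) c := by
  apply List.ext_getElem
  · simp; omega
  · intro i hi hi'
    simp only [List.getElem_append, List.length_append, List.length_take, List.length_singleton,
      List.getElem_take, List.getElem_replicate, List.getElem_singleton]
    split_ifs with q1 q2
    · rfl
    · obtain rfl : i = N - 1 := by omega
      rw [List.getD_eq_getElem _ _ hi]
    · have := hc (i + 1) (by omega) (by omega)
      rw [Nat.add_sub_cancel, List.getD_eq_getElem _ _ hi] at this
      exact this

theorem overlap (a : ℕ → ℝ) (k : ℕ → ℕ) (n : ℕ) (s u : List ℕ) (hu2 : ∀ x ∈ u, x ≤ 2)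
    (h : Associated k n s u) : ∃ N, k (n - 1) + 1 ≤ N ∧ N ≤ k n - 1 ∧
      Jr a u = Jl a s + (3 * dSeq a N - dSeq a (N - 1)) := by
  obtain ⟨hs, hu, hN, h1, h2, ht, hg⟩ := h
  refine ⟨Nidx 0 s, h1, h2, ?_⟩
  obtain ⟨⟨_, hs1⟩, hs2⟩ := Nidx_spec 0 s (by omega)
  obtain ⟨⟨_, hu1⟩, hu3⟩ := Nidx_spec 1 u (by omega)
  rw [← hN] at hu1 hu3
  set N := Nidx 0 s with hNd
  simp only [if_true] at hs1 hs2
  have es := split_at s N 0 (by omega) (by omega) (fun j hj hj' => by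
    have := hs2 j hj hj'; omega)
  have eu := split_at u N 2 (by omega) (by omega) (fun j hj hj' => by
    have q := hu3 j hj hj'
    simp only [one_ne_zero, if_false] at q
    have q2 := hu2 (u.getD (j - 1) 0) (by
      rw [List.getD_eq_getElem _ _ (show j - 1 < u.length by omega)]; exact List.getElem_mem _)
    omega)
  have lt : (s.take (N - 1)).length = N - 1 := by simp; omega
  rw [← ht, hg] at eu
  obtain ⟨c, hc⟩ : ∃ c, s.getD (N - 1) 0 = c + 1 := ⟨s.getD (N - 1) 0 - 1, by omega⟩
  rw [hc] at es eu
  rw [Nat.add_sub_cancel] at eu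
  have hN1 : N - 1 + 1 = N := by omega
  have e1 : Jl a s = Jl a (s.take (N - 1)) + (c + 1) * (dSeq a (N - 1) - dSeq a N) := by
    rw [es, Jl_replicate, Jl_snoc, ← es, lt, hN1]
    push_cast; ring
  have e2 : Jl a u = Jl a (s.take (N - 1)) + c * (dSeq a (N - 1) - dSeq a N)
      + 2 * (dSeq a N - dSeq a u.length) := by
    conv_lhs => rw [eu]
    rw [Jl_replicate, Jl_snoc, List.length_append, List.length_singleton, lt, hN1,
      show N + (u.length - N) = u.length by omega]
    push_cast; ring
  unfold Jr
  rw [e1, e2]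
  ring

theorem star_bounds {a : ℕ → ℝ} {k : ℕ → ℕ} {n : ℕ} (hn : 1 ≤ n) (hstar : condStar a k) {N : ℕ}
    (h1 : k (n - 1) + 1 ≤ N) (h2 : N ≤ k n - 1) :
    2 * tailSum a k n ≤ (3 * dSeq a N - dSeq a (N - 1)) - (dSeq a (k n - 1) - dSeq a (k n)) ∧
    2 * tailSum a k n ≤ 4 * dSeq a (k n) - (3 * dSeq a N - dSeq a (N - 1)) := by
  have h := le_min_iff.1 (hstar n hn)
  have m : (((3 * dSeq a N - dSeq a (N - 1) : ℝ)) : EReal) ∈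
    ((fun i => ((3 * dSeq a i - dSeq a (i - 1) : ℝ) : EReal)) ''
    (Set.Icc (k (n - 1) + 1) (k n - 1))) := ⟨N, ⟨h1, h2⟩, rfl⟩
  have b1 : deltaMin a k n ≤ _ := sInf_le m
  have b2 : _ ≤ deltaMax a k n := le_sSup m
  constructor
  · have := h.1.trans (EReal.sub_le_sub b1 le_rfl)
    exact_mod_cast this
  · have := h.2.trans (EReal.sub_le_sub le_rfl b2)
    exact_mod_cast this

theorem Gset_disj {a : ℕ → ℝ} {p q : ℕ × List ℕ}
    (h : Gr a p.1 p.2 ≤ Gl a q.1 q.2 ∨ Gr a q.1 q.2 ≤ Gl a p.1 p.2) :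
    Gset a p.1 p.2 ∩ Gset a q.1 q.2 = ∅ := by
  ext x
  simp only [Gset, Set.mem_inter_iff, Set.mem_Ioo, Set.mem_empty_iff_false, iff_false]
  rintro ⟨⟨_, _⟩, _, _⟩
  rcases h with h | h <;> linarith

/-- Claim 3: under condition `(*)`, if `J_s` and `J_u` (of length `kₙ - 1`) are associated
with `J_u` covering `𝒢⁰_s`, then any `G ∈ 𝒢⁰_s` and `H ∈ 𝒢¹_u` are disjoint; moreover,
any `D ∈ 𝒢¹_s` and `F ∈ 𝒢⁰_u` satisfy `D ∩ H = ∅`, `G ∩ F = ∅` and `D ∩ F = ∅`. -/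
theorem claim3_gap_disjointness (a : ℕ → ℝ) (k : ℕ → ℕ)
    (ha : ∀ n, 1 ≤ n → 0 < a n ∧ a n < 1)
    (hinf : {n : ℕ | 1 ≤ n ∧ 1 / 3 < a n}.Infinite)
    (hk0 : a (k 0 + 1) < 1 / 3)
    (hk : IsGapEnum a k)
    (hstar : condStar a k)
    (n : ℕ) (hn : 1 ≤ n)
    (s u : List ℕ) (hs2 : ∀ x ∈ s, x ≤ 2) (hu2 : ∀ x ∈ u, x ≤ 2)
    (hslen : s.length = k n - 1) (hulen : u.length = k n - 1)
    (hassoc : Associated k n s u) :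
    (∀ p ∈ gapFamilyAll k 0 s n, ∀ q ∈ gapFamilyAll k 1 u n,
        Gset a p.1 p.2 ∩ Gset a q.1 q.2 = ∅) ∧
      (∀ p ∈ gapFamilyAll k 1 s n, ∀ q ∈ gapFamilyAll k 1 u n,
        Gset a p.1 p.2 ∩ Gset a q.1 q.2 = ∅) ∧
      (∀ p ∈ gapFamilyAll k 0 s n, ∀ q ∈ gapFamilyAll k 0 u n,
        Gset a p.1 p.2 ∩ Gset a q.1 q.2 = ∅) ∧
      (∀ p ∈ gapFamilyAll k 1 s n, ∀ q ∈ gapFamilyAll k 0 u n,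
        Gset a p.1 p.2 ∩ Gset a q.1 q.2 = ∅) := by
  obtain ⟨N, hN1, hN2, hx⟩ := overlap a k n s u hu2 hassoc
  obtain ⟨b1, b2⟩ := star_bounds hn hstar hN1 hN2
  set x := 3 * dSeq a N - dSeq a (N - 1) with hxd
  have hT : 0 ≤ tailSum a k n := tsum_nonneg fun i => D_nonneg ha _
  obtain ⟨hk1, hk2⟩ := hk.2.1 n hn
  have hkk : k n - 1 + 1 = k n := by omega
  have g := dSeq_gap ha (k n - 1)
  rw [hkk] at g
  have g := g hk2
  have dp := dSeq_pos ha (k n)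
  have hJu : Jr a u = Jl a u + 2 * dSeq a (k n - 1) := by unfold Jr; rw [hulen]
  have s0l : Gl a 0 s = Jl a s + 2 * dSeq a (k n) := by
    unfold Gl; rw [hslen, hkk]; push_cast; ring
  have s0r : Gr a 0 s = Jl a s + (dSeq a (k n - 1) - dSeq a (k n)) := by
    unfold Gr; rw [hslen, hkk]; push_cast; ring
  have s1l : Gl a 1 s = Jl a s + dSeq a (k n - 1) + dSeq a (k n) := by
    unfold Gl; rw [hslen, hkk]; push_cast; ring
  have u0r : Gr a 0 u = Jl a u + (dSeq a (k n - 1) - dSeq a (k n)) := by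
    unfold Gr; rw [hulen, hkk]; push_cast; ring
  have u1l : Gl a 1 u = Jl a u + dSeq a (k n - 1) + dSeq a (k n) := by
    unfold Gl; rw [hulen, hkk]; push_cast; ring
  have u1r : Gr a 1 u = Jl a u + 2 * (dSeq a (k n - 1) - dSeq a (k n)) := by
    unfold Gr; rw [hulen, hkk]; push_cast; ring
  have hJs : Jr a s = Jl a s + 2 * dSeq a (k n - 1) := by unfold Jr; rw [hslen]
  have S0 := familyAll_bound ha hk hn 0 s hslen _ (Or.inl ⟨rfl, rfl⟩)
  have S1 := familyAll_bound ha hk hn 1 s hslen _ (Or.inr ⟨rfl, rfl⟩)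
  have U0 := familyAll_bound ha hk hn 0 u hulen _ (Or.inl ⟨rfl, rfl⟩)
  have U1 := familyAll_bound ha hk hn 1 u hulen _ (Or.inr ⟨rfl, rfl⟩)
  refine ⟨fun p hp q hq => ?_, fun p hp q hq => ?_, fun p hp q hq => ?_, fun p hp q hq => ?_⟩
  · rcases S0 p hp with ⟨p1, p2⟩ | ⟨p1, p2⟩ <;> rcases U1 q hq with ⟨q1, q2⟩ | ⟨q1, q2⟩
    · exact Gset_disj (Or.inl (by linarith))
    · exact Gset_disj (Or.inl (by linarith))
    · exact Gset_disj (Or.inl (by linarith))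
    · exact Gset_disj (Or.inr (by linarith))
  · rcases S1 p hp with ⟨p1, p2⟩ | ⟨p1, p2⟩ <;> rcases U1 q hq with ⟨q1, q2⟩ | ⟨q1, q2⟩ <;>
      exact Gset_disj (Or.inr (by linarith))
  · rcases S0 p hp with ⟨p1, p2⟩ | ⟨p1, p2⟩ <;> rcases U0 q hq with ⟨q1, q2⟩ | ⟨q1, q2⟩ <;>
      exact Gset_disj (Or.inr (by linarith))
  · rcases S1 p hp with ⟨p1, p2⟩ | ⟨p1, p2⟩ <;> rcases U0 q hq with ⟨q1, q2⟩ | ⟨q1, q2⟩ <;>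
      exact Gset_disj (Or.inr (by linarith))

end CCS
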